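/- Let S be a semigroup and let R be a nearly epsilon-strongly S-graded ring such that R_e is von Neumann regular for every e ∈ E(S). Then, for all s ∈ S, t ∈ V(s) and r ∈ R_s, the set R_t r is a left ideal of the ring R_{ts} and is generated as a left R_{ts}-ideal by an idempotent element of R_{ts}. -/

import Mathlib

open scoped Pointwise

/-- The set `E(S)` of idempotent elements of a semigroup `S`. -/
def idempotentSet (S : Type*) [Semigroup S] : Set S := {s | s * s = s}

/-- The set `V(s) = {t ∈ S ∣ sts = s and tst = t}`. -/
def invSet {S : Type*} [Semigroup S] (s : S) : Set S :=
  {t | s * t * s = s ∧ t * s * t = t}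

/-- The product `A B` of two additive subgroups of a ring: the additive subgroup
generated by all products `a * b` with `a ∈ A`, `b ∈ B`. -/
def subgroupMul {R : Type*} [NonUnitalRing R] (A B : AddSubgroup R) : AddSubgroup R :=
  AddSubgroup.closure ((A : Set R) * (B : Set R))

/-- `R` is an `S`-graded ring via the family `𝒜` of additive subgroups:
`R = ⊕_{s ∈ S} R_s` (internal direct sum) and `R_s R_t ⊆ R_{st}`. -/
structure IsSemigroupGrading {S R : Type*} [Semigroup S] [DecidableEq S] [NonUnitalRing R]
    (𝒜 : S → AddSubgroup R) : Prop where
  internal : DirectSum.IsInternal 𝒜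
  mul_mem : ∀ s t : S, ∀ a ∈ 𝒜 s, ∀ b ∈ 𝒜 t, a * b ∈ 𝒜 (s * t)

/-- `R` is symmetrically `S`-graded: `R_s = R_s R_t R_s` for all `s ∈ S`, `t ∈ V(s)`. -/
def SymmetricallyGraded {S R : Type*} [Semigroup S] [NonUnitalRing R]
    (𝒜 : S → AddSubgroup R) : Prop :=
  ∀ s : S, ∀ t ∈ invSet s, 𝒜 s = subgroupMul (subgroupMul (𝒜 s) (𝒜 t)) (𝒜 s)

/-- A subset `P` of `R` (closed under multiplication) is a unital ring:
it has a two-sided multiplicative identity element. -/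
def HasUnity {R : Type*} [NonUnitalRing R] (P : AddSubgroup R) : Prop :=
  ∃ u ∈ P, ∀ x ∈ P, u * x = x ∧ x * u = x

/-- A subset `P` of `R` is an s-unital ring: `x ∈ Px` and `x ∈ xP` for every `x ∈ P`. -/
def IsSUnital {R : Type*} [NonUnitalRing R] (P : AddSubgroup R) : Prop :=
  ∀ x ∈ P, (∃ u ∈ P, u * x = x) ∧ (∃ v ∈ P, x * v = x)

/-- A subset `P` of `R` is a von Neumann regular ring: `r ∈ rPr` for every `r ∈ P`. -/
def IsVonNeumannRegular {R : Type*} [NonUnitalRing R] (P : AddSubgroup R) : Prop :=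
  ∀ r ∈ P, ∃ x ∈ P, r = r * x * r

/-- `R` is epsilon-strongly `S`-graded. -/
def EpsilonStronglyGraded {S R : Type*} [Semigroup S] [NonUnitalRing R]
    (𝒜 : S → AddSubgroup R) : Prop :=
  SymmetricallyGraded 𝒜 ∧ ∀ s : S, ∀ t ∈ invSet s, HasUnity (subgroupMul (𝒜 s) (𝒜 t))

/-- `R` is nearly epsilon-strongly `S`-graded. -/
def NearlyEpsilonStronglyGraded {S R : Type*} [Semigroup S] [NonUnitalRing R]
    (𝒜 : S → AddSubgroup R) : Prop :=
  SymmetricallyGraded 𝒜 ∧ ∀ s : S, ∀ t ∈ invSet s, IsSUnital (subgroupMul (𝒜 s) (𝒜 t))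

/-- `R` is strongly `S`-graded: `R_s R_t = R_{st}` for all `s, t ∈ S`. -/
def StronglyGraded {S R : Type*} [Semigroup S] [NonUnitalRing R]
    (𝒜 : S → AddSubgroup R) : Prop :=
  ∀ s t : S, subgroupMul (𝒜 s) (𝒜 t) = 𝒜 (s * t)

/-- `R` is graded von Neumann regular: for all `s ∈ S`, `r ∈ R_s` and `t ∈ V(s)`,
there is `y ∈ R_t` with `r = ryr`. -/
def GradedVonNeumannRegular {S R : Type*} [Semigroup S] [NonUnitalRing R]
    (𝒜 : S → AddSubgroup R) : Prop :=
  ∀ s : S, ∀ r ∈ 𝒜 s, ∀ t ∈ invSet s, ∃ y ∈ 𝒜 t, r = r * y * r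

theorem mul_mem_subgroupMul {R : Type*} [NonUnitalRing R] {A B : AddSubgroup R}
    {a b : R} (ha : a ∈ A) (hb : b ∈ B) : a * b ∈ subgroupMul A B :=
  AddSubgroup.subset_closure (Set.mul_mem_mul ha hb)

theorem subgroupMul_induction {R : Type*} [NonUnitalRing R] {A B : AddSubgroup R}
    {p : R → Prop} (mul : ∀ a ∈ A, ∀ b ∈ B, p (a * b)) (zero : p 0)
    (add : ∀ x y, p x → p y → p (x + y)) (neg : ∀ x, p x → p (-x))
    {x : R} (hx : x ∈ subgroupMul A B) : p x := by
  induction hx using AddSubgroup.closure_induction with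
  | mem x hx =>
    obtain ⟨a, ha, b, hb, rfl⟩ := Set.mem_mul.mp hx
    exact mul a ha b hb
  | zero => exact zero
  | add x y _ _ hx hy => exact add x y hx hy
  | neg x _ hx => exact neg x hx

theorem subgroupMul_mul_mem {R : Type*} [NonUnitalRing R] {A B : AddSubgroup R}
    (h : ∀ a ∈ A, ∀ b ∈ B, ∀ c ∈ A, a * b * c ∈ A) {x y : R}
    (hx : x ∈ subgroupMul A B) (hy : y ∈ subgroupMul A B) : x * y ∈ subgroupMul A B := by
  refine subgroupMul_induction (p := fun x ↦ x * y ∈ subgroupMul A B) ?_ ?_ ?_ ?_ hx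
  · intro a ha b hb
    refine subgroupMul_induction (p := fun y ↦ a * b * y ∈ subgroupMul A B) ?_ ?_ ?_ ?_ hy
    · intro c hc d hd
      rw [← mul_assoc]
      exact mul_mem_subgroupMul (h a ha b hb c hc) hd
    · simp [zero_mem]
    · intro x y hx hy
      rw [mul_add]
      exact add_mem hx hy
    · intro x hx
      rw [mul_neg]
      exact neg_mem hx
  · simp [zero_mem]
  · intro x z hx hz
    rw [add_mul]
    exact add_mem hx hz
  · intro x hx
    rw [neg_mul]
    exact neg_mem hx

/-- If `P` is an s-unital ring, then every element of `P A` has a left unit in `P`. -/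
theorem IsSUnital.exists_left_unit {R : Type*} [NonUnitalRing R] {P A : AddSubgroup R}
    (hP : IsSUnital P) (hmul : ∀ x ∈ P, ∀ y ∈ P, x * y ∈ P) {r : R}
    (hr : r ∈ subgroupMul P A) : ∃ v ∈ P, v * r = r := by
  suffices ∀ v ∈ P, ∃ w ∈ P, w * r = r ∧ ∀ x, v * x = x → w * x = x by
    obtain ⟨w, hw, hwr, -⟩ := this 0 P.zero_mem
    exact ⟨w, hw, hwr⟩
  refine subgroupMul_induction
    (p := fun r ↦ ∀ v ∈ P, ∃ w ∈ P, w * r = r ∧ ∀ x, v * x = x → w * x = x) ?_ ?_ ?_ ?_ hr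
  · intro q hq a _ v hv
    obtain ⟨w, hw, hwq⟩ := (hP (q - v * q) (sub_mem hq (hmul v hv q hq))).1
    refine ⟨v + w - w * v, sub_mem (add_mem hv hw) (hmul w hw v hv), ?_, fun x hx ↦ ?_⟩
    · rw [← mul_assoc]
      congr 1
      rw [mul_sub] at hwq
      calc (v + w - w * v) * q = v * q + (w * q - w * (v * q)) := by noncomm_ring
        _ = q := by rw [hwq]; abel
    · rw [sub_mul, add_mul, mul_assoc, hx]
      abel
  · exact fun v hv ↦ ⟨v, hv, mul_zero v, fun _ h ↦ h⟩
  · intro x y hx hy v hv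
    obtain ⟨w, hw, hwx, hvw⟩ := hx v hv
    obtain ⟨w', hw', hwy, hww⟩ := hy w hw
    exact ⟨w', hw', by rw [mul_add, hww x hwx, hwy], fun z hz ↦ hww z (hvw z hz)⟩
  · intro x hx v hv
    obtain ⟨w, hw, hwx, hvw⟩ := hx v hv
    exact ⟨w, hw, by rw [mul_neg, hwx], hvw⟩

/-- In a left ideal `L` of a von Neumann regular ring `P`, an idempotent `e` and an element `a`
have a common idempotent right unit. -/
theorem IsVonNeumannRegular.exists_idempotent_right_unit {R : Type*} [NonUnitalRing R]
    {P L : AddSubgroup R} (hP : IsVonNeumannRegular P) (hLP : L ≤ P)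
    (hL : ∀ x ∈ P, ∀ y ∈ L, x * y ∈ L) {e a : R} (he : e ∈ L) (hee : e * e = e) (ha : a ∈ L) :
    ∃ u ∈ L, u * u = u ∧ e * u = e ∧ a * u = a := by
  have hb : a - a * e ∈ L := sub_mem ha (hL a (hLP ha) e he)
  obtain ⟨x, hx, hbx⟩ := hP _ (hLP hb)
  set b := a - a * e with hb_def
  have hbe : b * e = 0 := by rw [hb_def, sub_mul, mul_assoc, hee, sub_self]
  have hf : x * b ∈ L := hL x hx b hb
  have hbf : b * (x * b) = b := by rw [← mul_assoc, ← hbx]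
  set f := x * b with hf_def
  have hff : f * f = f := by
    conv_lhs => rw [hf_def, mul_assoc, hbf]
  have hfe : f * e = 0 := by rw [hf_def, mul_assoc, hbe, mul_zero]
  have heu : e * (e + f - e * f) = e := by
    rw [mul_sub, mul_add, ← mul_assoc e e f, hee, add_sub_cancel_right]
  refine ⟨e + f - e * f, sub_mem (add_mem he hf) (hL e (hLP he) f hf), ?_, heu, ?_⟩
  · have hfu : f * (e + f - e * f) = f := by
      rw [mul_sub, mul_add, ← mul_assoc f e f, hfe, hff, zero_mul, zero_add, sub_zero]
    rw [sub_mul, add_mul, heu, hfu, mul_assoc, hfu]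
  · have hbu : b * (e + f - e * f) = b := by
      rw [mul_sub, mul_add, ← mul_assoc b e f, hbe, hbf, zero_mul, zero_add, sub_zero]
    have hab : a = b + a * e := by rw [hb_def, sub_add_cancel]
    conv_lhs => rw [hab, add_mul, hbu, mul_assoc, heu]
    exact hab.symm

/-- If `B r` is a left ideal of a von Neumann regular ring `P`, then every element of
`A B r` has an idempotent right unit in `B r`. -/
theorem IsVonNeumannRegular.exists_idempotent_mul_eq {R : Type*} [NonUnitalRing R]
    {P L A B : AddSubgroup R} (hP : IsVonNeumannRegular P) (hLP : L ≤ P)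
    (hL : ∀ x ∈ P, ∀ y ∈ L, x * y ∈ L) {r v : R} (hB : ∀ y ∈ B, y * r ∈ L)
    (hv : v ∈ subgroupMul A B) : ∃ u ∈ L, u * u = u ∧ v * r * u = v * r := by
  suffices ∀ e ∈ L, e * e = e → ∃ u ∈ L, u * u = u ∧ e * u = e ∧ v * r * u = v * r by
    obtain ⟨u, hu, huu, -, hvu⟩ := this 0 L.zero_mem (mul_zero 0)
    exact ⟨u, hu, huu, hvu⟩
  refine subgroupMul_induction (p := fun v ↦ ∀ e ∈ L, e * e = e →
    ∃ u ∈ L, u * u = u ∧ e * u = e ∧ v * r * u = v * r) ?_ ?_ ?_ ?_ hv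
  · intro x _ y hy e he hee
    obtain ⟨u, hu, huu, heu, hyu⟩ :=
      hP.exists_idempotent_right_unit hLP hL he hee (hB y hy)
    exact ⟨u, hu, huu, heu, by rw [mul_assoc x, mul_assoc x, hyu]⟩
  · exact fun e he hee ↦ ⟨e, he, hee, hee, by simp only [zero_mul]⟩
  · intro x y hx hy e he hee
    obtain ⟨u, hu, huu, heu, hxu⟩ := hx e he hee
    obtain ⟨w, hw, hww, huw, hyw⟩ := hy u hu huu
    refine ⟨w, hw, hww, by rw [← heu, mul_assoc, huw], ?_⟩
    rw [add_mul, add_mul, hyw, ← hxu, mul_assoc (x * r), huw]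
  · intro x hx e he hee
    obtain ⟨u, hu, huu, heu, hxu⟩ := hx e he hee
    exact ⟨u, hu, huu, heu, by rw [neg_mul, neg_mul, hxu]⟩

/-- **Lemma (technical).** Let `R` be a nearly epsilon-strongly `S`-graded ring such that
`R_e` is von Neumann regular for every `e ∈ E(S)`. Then for all `s ∈ S`, `t ∈ V(s)` and
`r ∈ R_s`, the set `R_t r` is a left ideal of the ring `R_{ts}` and is generated, as a
left `R_{ts}`-ideal, by an idempotent element `u ∈ R_{ts}` (i.e. `R_t r = R_{ts} u`). -/
theorem leftIdeal_generated_by_idempotent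
    {S R : Type*} [Semigroup S] [DecidableEq S] [NonUnitalRing R]
    (𝒜 : S → AddSubgroup R) (hgr : IsSemigroupGrading 𝒜)
    (hnes : NearlyEpsilonStronglyGraded 𝒜)
    (hvn : ∀ e ∈ idempotentSet S, IsVonNeumannRegular (𝒜 e)) :
    ∀ s : S, ∀ t ∈ invSet s, ∀ r ∈ 𝒜 s,
      -- `R_t r ⊆ R_{ts}`
      {x : R | ∃ y ∈ 𝒜 t, x = y * r} ⊆ (𝒜 (t * s) : Set R) ∧
      -- `R_t r` is closed under subtraction
      (∀ x ∈ {x : R | ∃ y ∈ 𝒜 t, x = y * r}, ∀ x' ∈ {x : R | ∃ y ∈ 𝒜 t, x = y * r},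
        x - x' ∈ {x : R | ∃ y ∈ 𝒜 t, x = y * r}) ∧
      -- `R_t r` is a left ideal of `R_{ts}`
      (∀ a ∈ 𝒜 (t * s), ∀ x ∈ {x : R | ∃ y ∈ 𝒜 t, x = y * r},
        a * x ∈ {x : R | ∃ y ∈ 𝒜 t, x = y * r}) ∧
      -- `R_t r` is generated by an idempotent `u ∈ R_{ts}`, i.e. `R_t r = R_{ts} u`
      (∃ u ∈ 𝒜 (t * s), u * u = u ∧
        {x : R | ∃ y ∈ 𝒜 t, x = y * r} = {x : R | ∃ z ∈ 𝒜 (t * s), x = z * u}) := by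
  intro s t ht r hr
  have hts : t * s ∈ idempotentSet S := by
    change t * s * (t * s) = t * s
    rw [← mul_assoc, ht.2]
  have hsub : ∀ y ∈ 𝒜 t, y * r ∈ 𝒜 (t * s) := fun y hy ↦ hgr.mul_mem t s y hy r hr
  have hmul : ∀ a ∈ 𝒜 (t * s), ∀ y ∈ 𝒜 t, a * y ∈ 𝒜 t := fun a ha y hy ↦ by
    simpa only [ht.2] using hgr.mul_mem (t * s) t a ha y hy
  let L : AddSubgroup R := (𝒜 t).map (AddMonoidHom.mulRight r)
  have hLP : L ≤ 𝒜 (t * s) := by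
    rintro _ ⟨y, hy, rfl⟩
    exact hsub y hy
  have hL : ∀ a ∈ 𝒜 (t * s), ∀ x ∈ L, a * x ∈ L := by
    rintro a ha _ ⟨y, hy, rfl⟩
    exact ⟨a * y, hmul a ha y hy, mul_assoc a y r⟩
  refine ⟨?_, ?_, ?_, ?_⟩
  · rintro _ ⟨y, hy, rfl⟩
    exact hsub y hy
  · rintro _ ⟨y, hy, rfl⟩ _ ⟨z, hz, rfl⟩
    exact ⟨y - z, sub_mem hy hz, (sub_mul y z r).symm⟩
  · rintro a ha _ ⟨y, hy, rfl⟩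
    exact ⟨a * y, hmul a ha y hy, (mul_assoc a y r).symm⟩
  · have hsts : ∀ a ∈ 𝒜 s, ∀ b ∈ 𝒜 t, ∀ c ∈ 𝒜 s, a * b * c ∈ 𝒜 s := fun a ha b hb c hc ↦ by
      simpa only [ht.1] using hgr.mul_mem (s * t) s _ (hgr.mul_mem s t a ha b hb) c hc
    obtain ⟨v, hv, hvr⟩ := (hnes.2 s t ht).exists_left_unit
      (fun _ hx _ hy ↦ subgroupMul_mul_mem hsts hx hy) (hnes.1 s t ht ▸ hr)
    obtain ⟨u, hu, huu, hru⟩ := (hvn _ hts).exists_idempotent_mul_eq hLP hL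
      (fun y hy ↦ ⟨y, hy, rfl⟩) hv
    rw [hvr] at hru
    refine ⟨u, hLP hu, huu, Set.Subset.antisymm ?_ ?_⟩
    · rintro _ ⟨y, hy, rfl⟩
      exact ⟨y * r, hsub y hy, by rw [mul_assoc, hru]⟩
    · rintro _ ⟨z, hz, rfl⟩
      obtain ⟨y, hy, hyz⟩ := hL z hz u hu
      exact ⟨y, hy, hyz.symm⟩
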